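/- Let A be a ring and P a finitely generated projective left A-module with B = End_A(P)^op and F = Hom_A(P, −). The following are equivalent: (i) the canonical algebra map A → End_B(FA)^op, a ↦ (f ↦ f(−)·a), is an isomorphism (a double centralizer property on FA); (ii) for every finitely generated projective A-module M, the unit η_M : M → Hom_B(FA, FM) is an isomorphism; (iii) the restriction of F to finitely generated projective A-modules is fully faithful. -/

import Mathlib

open Function


section SchurFramework

variable {A : Type} [Ring A] {P : Type} [AddCommGroup P] [Module A P]

/-- `B = End_A(P)ᵒᵖ`. -/
abbrev Bop (A : Type) [Ring A] (P : Type) [AddCommGroup P] [Module A P] : Type :=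
  (Module.End A P)ᵐᵒᵖ

/-- `F M = Hom_A(P, M)` is a left `B`-module via precomposition. -/
instance instSMulBop (M : Type) [AddCommGroup M] [Module A M] :
    SMul (Bop A P) (P →ₗ[A] M) :=
  ⟨fun b φ => φ.comp b.unop⟩

@[simp] lemma smulBop_apply {M : Type} [AddCommGroup M] [Module A M]
    (b : Bop A P) (φ : P →ₗ[A] M) (p : P) : (b • φ) p = φ (b.unop p) := rfl

instance instModuleBop (M : Type) [AddCommGroup M] [Module A M] :
    Module (Bop A P) (P →ₗ[A] M) where
  one_smul φ := LinearMap.ext fun p => rfl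
  mul_smul b c φ := LinearMap.ext fun p => rfl
  smul_zero b := rfl
  smul_add b φ ψ := rfl
  add_smul b c φ := LinearMap.ext fun p => by
    simp only [smulBop_apply, MulOpposite.unop_add, LinearMap.add_apply, map_add]
  zero_smul φ := LinearMap.ext fun p => by
    simp only [smulBop_apply, MulOpposite.unop_zero, LinearMap.zero_apply, map_zero,
      LinearMap.zero_apply]

/-- Right multiplication by `a` on `F A = Hom_A(P, A)`, as a `B`-linear endomorphism.
This gives `F A` its right `A`-module structure. -/
def rmulA (a : A) : (P →ₗ[A] A) →ₗ[Bop A P] (P →ₗ[A] A) where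
  toFun f :=
    { toFun := fun p => f p * a
      map_add' := fun p q => by simp [add_mul]
      map_smul' := fun c p => by simp [smul_eq_mul, mul_assoc] }
  map_add' f g := LinearMap.ext fun p => by simp [add_mul]
  map_smul' b f := LinearMap.ext fun p => rfl

@[simp] lemma rmulA_apply (a : A) (f : P →ₗ[A] A) (p : P) : rmulA a f p = f p * a := rfl

lemma rmulA_one : (rmulA (A := A) (P := P) 1) = LinearMap.id :=
  LinearMap.ext fun f => LinearMap.ext fun p => by simp

lemma rmulA_mul (a b : A) :
    (rmulA (A := A) (P := P) (a * b)) = (rmulA b).comp (rmulA a) :=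
  LinearMap.ext fun f => LinearMap.ext fun p => by simp [mul_assoc]

lemma rmulA_add (a b : A) :
    (rmulA (A := A) (P := P) (a + b)) = rmulA a + rmulA b :=
  LinearMap.ext fun f => LinearMap.ext fun p => by simp [mul_add]

lemma rmulA_zero : (rmulA (A := A) (P := P) 0) = 0 :=
  LinearMap.ext fun f => LinearMap.ext fun p => by simp

/-- `G N = Hom_B(FA, N)` is a left `A`-module, via the right `A`-module structure of `FA`. -/
instance instSMulGA (N : Type) [AddCommGroup N] [Module (Bop A P) N] :
    SMul A ((P →ₗ[A] A) →ₗ[Bop A P] N) :=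
  ⟨fun a g => g.comp (rmulA a)⟩

@[simp] lemma smulGA_apply {N : Type} [AddCommGroup N] [Module (Bop A P) N]
    (a : A) (g : (P →ₗ[A] A) →ₗ[Bop A P] N) (f : P →ₗ[A] A) :
    (a • g) f = g (rmulA a f) := rfl

instance instModuleGA (N : Type) [AddCommGroup N] [Module (Bop A P) N] :
    Module A ((P →ₗ[A] A) →ₗ[Bop A P] N) where
  one_smul g := show g.comp (rmulA 1) = g by rw [rmulA_one, LinearMap.comp_id]
  mul_smul a b g := show g.comp (rmulA (a * b)) = (g.comp (rmulA b)).comp (rmulA a) by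
    rw [rmulA_mul, LinearMap.comp_assoc]
  smul_zero a := LinearMap.zero_comp _
  smul_add a g h := LinearMap.add_comp _ _ _
  add_smul a b g := show g.comp (rmulA (a + b)) = g.comp (rmulA a) + g.comp (rmulA b) by
    rw [rmulA_add, LinearMap.comp_add]
  zero_smul g := show g.comp (rmulA 0) = 0 by rw [rmulA_zero, LinearMap.comp_zero]

/-- For `f ∈ Hom_A(P, A)` and `x ∈ X`, the map `p ↦ f p • x`, an element of `F X`. -/
def starMap {X : Type} [AddCommGroup X] [Module A X] (f : P →ₗ[A] A) (x : X) :
    P →ₗ[A] X where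
  toFun p := f p • x
  map_add' p q := by simp [add_smul]
  map_smul' a p := by simp [smul_eq_mul, mul_smul]

@[simp] lemma starMap_apply {X : Type} [AddCommGroup X] [Module A X]
    (f : P →ₗ[A] A) (x : X) (p : P) : starMap f x p = f p • x := rfl

lemma starMap_addl {X : Type} [AddCommGroup X] [Module A X] (f g : P →ₗ[A] A) (x : X) :
    starMap (f + g) x = starMap f x + starMap g x :=
  LinearMap.ext fun p => by simp [add_smul]

lemma starMap_smulB {X : Type} [AddCommGroup X] [Module A X] (b : Bop A P)
    (f : P →ₗ[A] A) (x : X) : starMap (b • f) x = b • starMap f x :=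
  LinearMap.ext fun p => rfl

lemma starMap_smulA {X : Type} [AddCommGroup X] [Module A X] (a : A)
    (f : P →ₗ[A] A) (x : X) : starMap f (a • x) = starMap (rmulA a f) x :=
  LinearMap.ext fun p => by simp [mul_smul]

/-- The adjunction bijection `Φ : Hom_B(F X, M) → Hom_A(X, G M)` of `F ⊣ G`. -/
def PhiAdj {X : Type} [AddCommGroup X] [Module A X]
    {M : Type} [AddCommGroup M] [Module (Bop A P) M]
    (k : (P →ₗ[A] X) →ₗ[Bop A P] M) :
    X →ₗ[A] ((P →ₗ[A] A) →ₗ[Bop A P] M) where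
  toFun x :=
    { toFun := fun f => k (starMap f x)
      map_add' := fun f g => by
        show k (starMap (f + g) x) = k (starMap f x) + k (starMap g x)
        rw [starMap_addl, map_add]
      map_smul' := fun b f => by
        show k (starMap (b • f) x) = b • k (starMap f x)
        rw [starMap_smulB, map_smul] }
  map_add' x y := LinearMap.ext fun f => by
    have : starMap f (x + y) = starMap f x + starMap f y :=
      LinearMap.ext fun p => by simp [smul_add]
    simp [this]
  map_smul' a x := LinearMap.ext fun f => by
    simp [starMap_smulA]

/-- `G` on morphisms: post-composition. -/
def Gmap {M N : Type} [AddCommGroup M] [Module (Bop A P) M]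
    [AddCommGroup N] [Module (Bop A P) N] (g : M →ₗ[Bop A P] N) :
    ((P →ₗ[A] A) →ₗ[Bop A P] M) →ₗ[A] ((P →ₗ[A] A) →ₗ[Bop A P] N) where
  toFun φ := g.comp φ
  map_add' φ ψ := LinearMap.ext fun f => by simp
  map_smul' a φ := LinearMap.ext fun f => rfl


/-- `F` on morphisms: post-composition with `h`. -/
def Fmap {M N : Type} [AddCommGroup M] [Module A M] [AddCommGroup N] [Module A N]
    (h : M →ₗ[A] N) : (P →ₗ[A] M) →ₗ[Bop A P] (P →ₗ[A] N) where
  toFun φ := h.comp φ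
  map_add' φ ψ := LinearMap.ext fun p => by simp
  map_smul' b φ := LinearMap.ext fun p => rfl

/-- The unit `η_X : X → G F X` of the adjunction `F ⊣ G`;
explicitly `η x f p = f p • x`. -/
def etaL (X : Type) [AddCommGroup X] [Module A X] :
    X →ₗ[A] ((P →ₗ[A] A) →ₗ[Bop A P] (P →ₗ[A] X)) :=
  PhiAdj (LinearMap.id : (P →ₗ[A] X) →ₗ[Bop A P] (P →ₗ[A] X))

end SchurFramework

section Unit

variable {A : Type} [Ring A] {P : Type} [AddCommGroup P] [Module A P]

@[simp] lemma etaL_apply {M : Type} [AddCommGroup M] [Module A M] (x : M) (f : P →ₗ[A] A) :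
    etaL M x f = starMap f x := rfl

@[simp] lemma Fmap_apply {M N : Type} [AddCommGroup M] [Module A M] [AddCommGroup N] [Module A N]
    (h : M →ₗ[A] N) (φ : P →ₗ[A] M) : Fmap h φ = h.comp φ := rfl

/-- Naturality of the unit. -/
lemma etaL_naturality {M N : Type} [AddCommGroup M] [Module A M] [AddCommGroup N] [Module A N]
    (h : M →ₗ[A] N) (x : M) :
    etaL (P := P) N (h x) = (Fmap h).comp (etaL M x) :=
  LinearMap.ext fun f => LinearMap.ext fun p => by simp

lemma comp_starMap {M N : Type} [AddCommGroup M] [Module A M] [AddCommGroup N] [Module A N]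
    (h : M →ₗ[A] N) (f : P →ₗ[A] A) (x : M) : h.comp (starMap f x) = starMap f (h x) :=
  LinearMap.ext fun p => by simp

/-- The unit at the regular module is the canonical map `A → End_B(FA)`. -/
lemma bijective_op_rmulA_iff :
    Bijective (fun a : A => MulOpposite.op (rmulA (A := A) (P := P) a)) ↔
      Bijective (etaL (A := A) (P := P) A) :=
  MulOpposite.opEquiv.bijective.of_comp_iff' (etaL (A := A) (P := P) A)

/-- If the unit is bijective at the regular module, it is so at all finitely generated projective
modules. -/
lemma bijective_etaL_of_self (hA : Bijective (etaL (A := A) (P := P) A))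
    (M : Type) [AddCommGroup M] [Module A M] [Module.Finite A M] [Module.Projective A M] :
    Bijective (etaL (A := A) (P := P) M) := by
  obtain ⟨n, π, s, -, -, hπs⟩ := Module.Finite.exists_comp_eq_id_of_projective A M
  have hπs' (x : M) : π (s x) = x := LinearMap.congr_fun hπs x
  let c (i : Fin n) : M →ₗ[A] A := (LinearMap.proj i).comp s
  refine ⟨fun x y hxy => ?_, fun g => ?_⟩
  · rw [← hπs' x, ← hπs' y]
    congr 1
    funext i
    refine hA.1 (?_ : etaL A (c i x) = etaL A (c i y))
    rw [etaL_naturality, etaL_naturality, hxy]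
  · choose a ha using fun i => hA.2 ((Fmap (c i)).comp g)
    refine ⟨π a, LinearMap.ext fun f => LinearMap.ext fun p => ?_⟩
    have hsa : f p • a = s (g f p) := by
      funext i
      exact LinearMap.congr_fun (LinearMap.congr_fun (ha i) f) p
    rw [etaL_apply, starMap_apply, ← map_smul, hsa, hπs']

/-- The maps `starMap f x` generate `Hom_A(P, M)` when `P` is finitely generated projective. -/
lemma exists_sum_starMap [Module.Finite A P] [Module.Projective A P]
    {M : Type} [AddCommGroup M] [Module A M] (φ : P →ₗ[A] M) :
    ∃ (n : ℕ) (f : Fin n → P →ₗ[A] A) (x : Fin n → M), φ = ∑ i, starMap (f i) (x i) := by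
  obtain ⟨n, π, s, -, -, hπs⟩ := Module.Finite.exists_comp_eq_id_of_projective A P
  refine ⟨n, fun i => (LinearMap.proj i).comp s, fun i => φ (π (Pi.single i 1)),
    LinearMap.ext fun p => ?_⟩
  have hp : π (s p) = p := LinearMap.congr_fun hπs p
  conv_lhs => rw [← hp, pi_eq_sum_univ' (s p)]
  simp [map_sum]

lemma bijective_Fmap_of_bijective_etaL [Module.Finite A P] [Module.Projective A P]
    {M N : Type} [AddCommGroup M] [Module A M] [AddCommGroup N] [Module A N]
    (hN : Bijective (etaL (A := A) (P := P) N)) :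
    Bijective (fun h : M →ₗ[A] N => Fmap (A := A) (P := P) h) := by
  refine ⟨fun h h' hh => LinearMap.ext fun x => hN.1 ?_, fun k => ?_⟩
  · rw [etaL_naturality, etaL_naturality]
    exact congrArg (fun u => u.comp (etaL M x)) hh
  · let e := LinearEquiv.ofBijective (etaL (A := A) (P := P) N) hN
    let h : M →ₗ[A] N := e.symm.toLinearMap.comp (PhiAdj k)
    have hk (f : P →ₗ[A] A) (x : M) : starMap f (h x) = k (starMap f x) :=
      LinearMap.congr_fun (e.apply_symm_apply (PhiAdj k x)) f
    refine ⟨h, LinearMap.ext fun φ => ?_⟩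
    obtain ⟨n, f, x, rfl⟩ := exists_sum_starMap φ
    simp only [map_sum]
    exact Finset.sum_congr rfl fun i _ => (comp_starMap h (f i) (x i)).trans (hk (f i) (x i))

lemma bijective_etaL_of_bijective_Fmap {M : Type} [AddCommGroup M] [Module A M]
    (h : Bijective (fun h : A →ₗ[A] M => Fmap (A := A) (P := P) h)) :
    Bijective (etaL (A := A) (P := P) M) := by
  have hspan : Bijective (fun x : M => LinearMap.toSpanSingleton A M x) :=
    ⟨fun x y hxy => by simpa using LinearMap.congr_fun hxy 1,
      fun u => ⟨u 1, LinearMap.ext_ring (by simp)⟩⟩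
  exact h.comp hspan

end Unit

/-- With `P` a finitely generated projective left `A`-module,
`B = End_A(P)ᵒᵖ` and `F = Hom_A(P,−)`, the following are equivalent:
(i) the canonical algebra map `A → End_B(FA)ᵒᵖ`, `a ↦ (f ↦ f(−)·a)`, is an isomorphism
    (double centralizer property on `FA`);
(ii) for every finitely generated projective `A`-module `M`, the unit
    `η_M : M → Hom_B(FA, FM)` is an isomorphism;
(iii) the restriction of `F` to finitely generated projective `A`-modules is fully faithful. -/
theorem double_centralizer_tfae
    (A : Type) [Ring A] (P : Type) [AddCommGroup P] [Module A P]
    [Module.Finite A P] [Module.Projective A P] :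
    (Function.Bijective
        (fun a : A => MulOpposite.op (rmulA (A := A) (P := P) a)) ↔
      ∀ (M : Type) [AddCommGroup M] [Module A M],
        Module.Finite A M → Module.Projective A M →
          Function.Bijective (etaL (A := A) (P := P) M)) ∧
    ((∀ (M : Type) [AddCommGroup M] [Module A M],
        Module.Finite A M → Module.Projective A M →
          Function.Bijective (etaL (A := A) (P := P) M)) ↔
      ∀ (M N : Type) [AddCommGroup M] [Module A M] [AddCommGroup N] [Module A N],
        Module.Finite A M → Module.Projective A M →
        Module.Finite A N → Module.Projective A N →
          Function.Bijective (fun h : M →ₗ[A] N => Fmap (A := A) (P := P) h)) := by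
  refine ⟨⟨fun h M _ _ _ _ => bijective_etaL_of_self (bijective_op_rmulA_iff.1 h) M,
    fun h => bijective_op_rmulA_iff.2 (h A inferInstance inferInstance)⟩,
    ⟨fun h M N _ _ _ _ _ _ hN hN' => bijective_Fmap_of_bijective_etaL (h N hN hN'),
    fun h M _ _ hM hM' =>
      bijective_etaL_of_bijective_Fmap (h A M inferInstance inferInstance hM hM')⟩⟩
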